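/- arXiv:2310.13534 — 3 statements merged into one kernel-verified Lean document; each statement's English description precedes it below -/
import Mathlib

section
/- Let ω be a continuous function on [a,b] that is positive almost everywhere, and let φ_0, φ_1, …, φ_{2N+1} be a Chebyshev system of continuous functions on [a,b]. Then there exist unique nodes a < x_0 < x_1 < … < x_N < b in the open interval (a,b) and unique weights w_0, w_1, …, w_N, all strictly positive, such that ∫_a^b φ_j(x) ω(x) dx = Σ_{k=0}^{N} φ_j(x_k) w_k for every j = 0, 1, …, 2N+1. -/
open MeasureTheory

/-- A finite family of continuous functions `φ 0, …, φ (n-1)` on `[a,b]` is a Chebyshev system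
if for every choice of pairwise distinct points in `[a,b]` the matrix `(φ i (x j))` has
nonzero determinant. -/
def IsChebyshevSystem (a b : ℝ) {n : ℕ} (φ : Fin n → ℝ → ℝ) : Prop :=
  (∀ i, ContinuousOn (φ i) (Set.Icc a b)) ∧
  ∀ x : Fin n → ℝ, (∀ i, x i ∈ Set.Icc a b) → Function.Injective x →
    (Matrix.of fun i j => φ i (x j)).det ≠ 0

open Filter Topology

namespace IsChebyshevSystem

variable {a b : ℝ}

lemma exists_sign_strictMono {n : ℕ} {φ : Fin n → ℝ → ℝ}
    (h : IsChebyshevSystem a b φ) (hc : ∀ i, Continuous (φ i)) :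
    ∃ σ : ℝ, ∀ x : Fin n → ℝ, StrictMono x → (∀ i, x i ∈ Set.Icc a b) →
      0 < σ * (Matrix.of fun i j => φ i (x j)).det := by
  set S : Set (Fin n → ℝ) := {x | StrictMono x ∧ ∀ i, x i ∈ Set.Icc a b} with hS
  have hconv : Convex ℝ S := by
    rintro x ⟨hx, hx'⟩ y ⟨hy, hy'⟩ s t hs ht hst
    refine ⟨fun i j hij => ?_, fun i => convex_Icc a b (hx' i) (hy' i) hs ht hst⟩
    have h1 := hx hij
    have h2 := hy hij
    simp only [Pi.add_apply, Pi.smul_apply, smul_eq_mul]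
    rcases hs.eq_or_lt with rfl | hs
    · have : t = 1 := by linarith
      subst this
      linarith
    · nlinarith [mul_lt_mul_of_pos_left h1 hs, mul_le_mul_of_nonneg_left h2.le ht]
  have hcont : Continuous fun x : Fin n → ℝ => (Matrix.of fun i j => φ i (x j)).det := by
    apply Continuous.matrix_det
    refine continuous_matrix fun i j => ?_
    exact (hc i).comp (continuous_apply j)
  have hpre := hconv.isPreconnected.image _ hcont.continuousOn
  by_cases hne : S.Nonempty
  · obtain ⟨x₀, hx₀⟩ := hne
    refine ⟨(Matrix.of fun i j => φ i (x₀ j)).det, fun x hx hx' => ?_⟩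
    have n0 := h.2 x₀ hx₀.2 hx₀.1.injective
    have n1 := h.2 x hx' hx.injective
    by_contra hneg
    have hlt := lt_of_le_of_ne (not_lt.1 hneg) (mul_ne_zero n0 n1)
    have hmem : (0 : ℝ) ∈ (fun x : Fin n → ℝ => (Matrix.of fun i j => φ i (x j)).det) '' S := by
      have o := hpre.ordConnected
      rcases mul_neg_iff.1 hlt with ⟨p, q⟩ | ⟨p, q⟩
      · exact o.out ⟨x, ⟨hx, hx'⟩, rfl⟩ ⟨x₀, hx₀, rfl⟩ ⟨q.le, p.le⟩
      · exact o.out ⟨x₀, hx₀, rfl⟩ ⟨x, ⟨hx, hx'⟩, rfl⟩ ⟨p.le, q.le⟩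
    obtain ⟨y, hy, hy0⟩ := hmem
    exact h.2 y hy.2 hy.1.injective hy0
  · exact ⟨0, fun x hx hx' => (hne ⟨x, hx, hx'⟩).elim⟩

lemma exists_sign_injective {n : ℕ} {φ : Fin n → ℝ → ℝ}
    (h : IsChebyshevSystem a b φ) (hc : ∀ i, Continuous (φ i)) :
    ∃ σ : ℝ, ∀ x : Fin n → ℝ, Function.Injective x → (∀ i, x i ∈ Set.Icc a b) →
      0 < σ * (Matrix.of fun i j => φ i (x j)).det * (Matrix.vandermonde x).det := by
  obtain ⟨σ, hσ⟩ := h.exists_sign_strictMono hc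
  refine ⟨σ, fun x hx hx' => ?_⟩
  have hmono : StrictMono (x ∘ Tuple.sort x) :=
    (Tuple.monotone_sort x).strictMono_of_injective (hx.comp (Equiv.injective _))
  have h1 := hσ _ hmono fun i => hx' _
  have h2 : 0 < (Matrix.vandermonde (x ∘ Tuple.sort x)).det := by
    rw [Matrix.det_vandermonde]
    refine Finset.prod_pos fun i _ => Finset.prod_pos fun j hj => ?_
    exact sub_pos.2 (hmono (Finset.mem_Ioi.1 hj))
  have e1 : (Matrix.of fun i j => φ i ((x ∘ Tuple.sort x) j)).det
      = Equiv.Perm.sign (Tuple.sort x) * (Matrix.of fun i j => φ i (x j)).det :=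
    Matrix.det_permute' (Tuple.sort x) (Matrix.of fun i j => φ i (x j))
  have e2 : (Matrix.vandermonde (x ∘ Tuple.sort x)).det
      = Equiv.Perm.sign (Tuple.sort x) * (Matrix.vandermonde x).det :=
    Matrix.det_permute (Tuple.sort x) (Matrix.vandermonde x)
  have h3 := mul_pos h1 h2
  rw [e1, e2] at h3
  rcases Int.units_eq_one_or (Equiv.Perm.sign (Tuple.sort x)) with h4 | h4 <;>
    simp only [h4] at h3 <;> push_cast at h3 <;> linarith

/-- A linear relation between the values at more points than there are functions
can be chosen with alternating signs. -/
lemma exists_alternating_relation {n : ℕ} {φ : Fin n → ℝ → ℝ}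
    (h : IsChebyshevSystem a b φ) (hc : ∀ i, Continuous (φ i))
    {x : Fin (n + 1) → ℝ} (hx : StrictMono x) (hx' : ∀ i, x i ∈ Set.Icc a b) :
    ∃ v : Fin (n + 1) → ℝ, (∀ l : Fin (n + 1), 0 < (-1) ^ (l : ℕ) * v l) ∧
      ∀ j, ∑ l, v l * φ j (x l) = 0 := by
  obtain ⟨σ, hσ⟩ := h.exists_sign_strictMono hc
  refine ⟨fun l => (-1) ^ (l : ℕ) * (σ * (Matrix.of fun i j => φ i (x (l.succAbove j))).det),
    fun l => ?_, fun j => ?_⟩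
  · rw [← mul_assoc, ← mul_pow]
    simpa using hσ _ (hx.comp (Fin.strictMono_succAbove l)) fun i => hx' _
  · let A : Matrix (Fin (n + 1)) (Fin (n + 1)) ℝ :=
      Matrix.of fun i l => (Fin.cons (φ j) φ : Fin (n + 1) → ℝ → ℝ) i (x l)
    have hA : A.det = 0 := by
      apply Matrix.det_zero_of_row_eq (i := 0) (j := j.succ) (Fin.succ_ne_zero j).symm
      ext l
      simp [A]
    rw [Matrix.det_succ_row_zero] at hA
    calc _ = σ * ∑ l : Fin (n + 1), (-1) ^ (l : ℕ) * A 0 l *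
            (A.submatrix Fin.succ l.succAbove).det := by
          rw [Finset.mul_sum]
          refine Finset.sum_congr rfl fun l _ => ?_
          have e : A.submatrix Fin.succ l.succAbove
              = Matrix.of fun i j => φ i (x (l.succAbove j)) := by
            ext i k
            simp [A]
          rw [e]
          simp only [A, Matrix.of_apply, Fin.cons_zero]
          ring
      _ = 0 := by rw [hA, mul_zero]

lemma eq_zero_of_forall_Icc {n : ℕ} {φ : Fin n → ℝ → ℝ} (hab : a < b)
    (h : IsChebyshevSystem a b φ) {α : Fin n → ℝ}
    (hα : ∀ t ∈ Set.Icc a b, ∑ i, α i * φ i t = 0) : α = 0 := by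
  have : Infinite (Set.Icc a b) := Set.infinite_coe_iff.2 (Set.Icc_infinite hab)
  let x : Fin n → ℝ := fun i => (Infinite.natEmbedding (Set.Icc a b) i : ℝ)
  have hx : Function.Injective x := fun i j hij =>
    Fin.ext ((Infinite.natEmbedding (Set.Icc a b)).injective (Subtype.ext hij))
  have hx' : ∀ i, x i ∈ Set.Icc a b := fun i =>
    (Infinite.natEmbedding (Set.Icc a b) i).2
  refine Matrix.eq_zero_of_vecMul_eq_zero (h.2 x hx' hx) ?_
  ext j
  exact hα _ (hx' j)

lemma eq_zero_of_sum_eq_zero {n : ℕ} {φ : Fin n → ℝ → ℝ} (hab : a < b)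
    (h : IsChebyshevSystem a b φ) {Z : Finset ℝ} (hZ : ∀ z ∈ Z, z ∈ Set.Icc a b)
    (hcard : Z.card ≤ n) {f : ℝ → ℝ} (hf : ∀ j, ∑ z ∈ Z, f z * φ j z = 0) :
    ∀ z ∈ Z, f z = 0 := by
  classical
  obtain ⟨Z', hZZ', hZ', hcard'⟩ : ∃ Z' : Finset ℝ, Z ⊆ Z' ∧ (∀ z ∈ Z', z ∈ Set.Icc a b) ∧
      Z'.card = n := by
    obtain ⟨u, hu, hcu⟩ := ((Set.Icc_infinite hab).sdiff Z.finite_toSet).exists_subset_card_eq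
      (n - Z.card)
    refine ⟨Z ∪ u, Finset.subset_union_left, fun z hz => ?_, ?_⟩
    · rcases Finset.mem_union.1 hz with hz | hz
      exacts [hZ z hz, (hu hz).1]
    · rw [Finset.card_union_of_disjoint (Finset.disjoint_right.2 fun z hz => (hu hz).2), hcu]
      omega
  let x := Z'.orderEmbOfFin hcard'
  have hx' : ∀ i, x i ∈ Set.Icc a b := fun i => hZ' _ (Z'.orderEmbOfFin_mem hcard' i)
  have key := Matrix.eq_zero_of_mulVec_eq_zero (h.2 x hx' x.injective)
    (v := fun i => if x i ∈ Z then f (x i) else 0) ?_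
  · intro z hz
    obtain ⟨i, rfl⟩ : z ∈ Set.range x := by
      rw [Finset.range_orderEmbOfFin]; exact hZZ' hz
    simpa [hz] using congrFun key i
  · ext j
    have e : Finset.univ.image x = Z' := by
      rw [← Finset.coe_inj, Finset.coe_image, Finset.coe_univ, Set.image_univ]
      exact Finset.range_orderEmbOfFin _ _
    calc ∑ i, φ j (x i) * (if x i ∈ Z then f (x i) else 0)
        = ∑ z ∈ Z', φ j z * (if z ∈ Z then f z else 0) := by
          rw [← e, Finset.sum_image fun i _ k _ hik => x.injective hik]
      _ = ∑ z ∈ Z, φ j z * (if z ∈ Z then f z else 0) := by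
          refine (Finset.sum_subset hZZ' fun z _ hz => ?_).symm
          simp [hz]
      _ = ∑ z ∈ Z, f z * φ j z :=
          Finset.sum_congr rfl fun z hz => by rw [if_pos hz, mul_comm]
      _ = 0 := hf j

lemma exists_sum_mul_prod_nonneg_of_injective {n : ℕ} {φ : Fin (n + 1) → ℝ → ℝ} (hab : a < b)
    (h : IsChebyshevSystem a b φ) (hc : ∀ i, Continuous (φ i))
    {x : Fin n → ℝ} (hx : Function.Injective x) (hx' : ∀ l, x l ∈ Set.Icc a b) :
    ∃ α : Fin (n + 1) → ℝ, ‖α‖ = 1 ∧ (∀ l, ∑ i, α i * φ i (x l) = 0) ∧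
      ∀ t ∈ Set.Icc a b, 0 ≤ (∑ i, α i * φ i t) * ∏ l, (x l - t) := by
  obtain ⟨σ, hσ⟩ := h.exists_sign_injective hc
  let α : Fin (n + 1) → ℝ := fun i =>
    (-1) ^ (i : ℕ) * (Matrix.of fun k l => φ (i.succAbove k) (x l)).det
  have hdet : ∀ t, (Matrix.of fun i j => φ i ((Fin.cons t x : Fin (n + 1) → ℝ) j)).det
      = ∑ i, α i * φ i t := by
    intro t
    rw [Matrix.det_succ_column_zero]
    refine Finset.sum_congr rfl fun i _ => ?_
    have e : ((Matrix.of fun i j => φ i ((Fin.cons t x : Fin (n + 1) → ℝ) j)).submatrix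
        i.succAbove Fin.succ) = Matrix.of fun k l => φ (i.succAbove k) (x l) := by
      ext k l
      simp
    rw [e]
    simp only [α, Matrix.of_apply, Fin.cons_zero]
    ring
  have hvand : ∀ t, (Matrix.vandermonde (Fin.cons t x : Fin (n + 1) → ℝ)).det
      = (∏ l, (x l - t)) * (Matrix.vandermonde x).det := by
    intro t
    rw [Matrix.det_vandermonde, Matrix.det_vandermonde, Fin.prod_univ_succ, Fin.prod_Ioi_zero]
    simp [Fin.prod_Ioi_succ]
  have hzero : ∀ l, ∑ i, α i * φ i (x l) = 0 := by
    intro l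
    rw [← hdet]
    refine Matrix.det_zero_of_column_eq (i := 0) (j := l.succ) (Fin.succ_ne_zero l).symm ?_
    simp
  have hpos : ∀ t ∈ Set.Icc a b, t ∉ Set.range x →
      0 < σ * (Matrix.vandermonde x).det * ((∑ i, α i * φ i t) * ∏ l, (x l - t)) := by
    intro t ht htx
    have := hσ (Fin.cons t x) (Fin.cons_injective_iff.2 ⟨htx, hx⟩)
      (Fin.cases (by simpa using ht) (by simpa using hx'))
    rw [hdet, hvand] at this
    linarith
  obtain ⟨t₀, ht₀, ht₀x⟩ := (Set.Icc_infinite hab).exists_notMem_finite (Set.finite_range x)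
  set β : Fin (n + 1) → ℝ := (σ * (Matrix.vandermonde x).det) • α with hβ
  have hβsum : ∀ t, ∑ i, β i * φ i t = σ * (Matrix.vandermonde x).det * ∑ i, α i * φ i t := by
    intro t
    rw [Finset.mul_sum]
    exact Finset.sum_congr rfl fun i _ => by simp [hβ, mul_assoc]
  have hβ0 : β ≠ 0 := by
    intro h0
    have h1 := hpos t₀ ht₀ ht₀x
    have h2 := hβsum t₀
    rw [← mul_assoc, ← h2, h0] at h1
    simp at h1
  have hγ : ∀ t, ∑ i, (‖β‖⁻¹ • β) i * φ i t = ‖β‖⁻¹ * ∑ i, β i * φ i t := by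
    intro t
    rw [Finset.mul_sum]
    exact Finset.sum_congr rfl fun i _ => by simp [mul_assoc]
  refine ⟨‖β‖⁻¹ • β, norm_smul_inv_norm hβ0, fun l => ?_, fun t ht => ?_⟩
  · rw [hγ, hβsum, hzero, mul_zero, mul_zero]
  · rw [hγ, mul_assoc]
    refine mul_nonneg (by positivity) ?_
    by_cases htx : t ∈ Set.range x
    · obtain ⟨l, rfl⟩ := htx
      rw [hβsum, hzero, mul_zero, zero_mul]
    · rw [hβsum, mul_assoc]
      exact (hpos t ht htx).le

/-- Prescribed zeros of a generalized polynomial, counted with multiplicity: it has the sign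
of the corresponding product. -/
lemma exists_sum_mul_prod_nonneg {n : ℕ} {φ : Fin (n + 1) → ℝ → ℝ} (hab : a < b)
    (h : IsChebyshevSystem a b φ) (hc : ∀ i, Continuous (φ i))
    {y : Fin n → ℝ} (hy : ∀ l, y l ∈ Set.Icc a b) :
    ∃ α : Fin (n + 1) → ℝ, α ≠ 0 ∧ (∀ l, ∑ i, α i * φ i (y l) = 0) ∧
      ∀ t ∈ Set.Icc a b, 0 ≤ (∑ i, α i * φ i t) * ∏ l, (y l - t) := by
  have : Infinite (Set.Icc a b) := Set.infinite_coe_iff.2 (Set.Icc_infinite hab)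
  let z : Fin n → ℝ := fun i => (Infinite.natEmbedding (Set.Icc a b) i : ℝ)
  have hz : Function.Injective z := fun i j hij =>
    Fin.ext ((Infinite.natEmbedding (Set.Icc a b)).injective (Subtype.ext hij))
  have hz' : ∀ i, z i ∈ Set.Icc a b := fun i => (Infinite.natEmbedding (Set.Icc a b) i).2
  let X : ℝ → Fin n → ℝ := fun s l => (1 - s) * y l + s * z l
  have hXc : ∀ l, Continuous fun s => X s l := fun l => by fun_prop
  have hX0 : ∀ l, X 0 l = y l := fun l => by simp [X]
  have hinj : ∀ᶠ s in 𝓝[>] (0 : ℝ), Function.Injective (X s) := by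
    have : ∀ l m, l ≠ m → ∀ᶠ s in 𝓝[>] (0 : ℝ), X s l ≠ X s m := by
      intro l m hlm
      by_cases hyy : y l = y m
      · filter_upwards [self_mem_nhdsWithin] with s hs heq
        have : s * z l = s * z m := by
          simp only [X, hyy] at heq
          linarith
        exact hlm (hz (mul_left_cancel₀ (ne_of_gt hs) this))
      · refine nhdsWithin_le_nhds ?_
        refine (isOpen_ne_fun (hXc l) (hXc m)).mem_nhds ?_
        simpa [X] using hyy
    have h2 : ∀ᶠ s in 𝓝[>] (0 : ℝ), ∀ l m, l ≠ m → X s l ≠ X s m := by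
      simp only [Filter.eventually_all]
      exact this
    filter_upwards [h2] with s hs l m hlm
    by_contra hne
    exact hs l m hne hlm
  have hmem : ∀ᶠ s in 𝓝[>] (0 : ℝ), ∀ l, X s l ∈ Set.Icc a b := by
    filter_upwards [Ioc_mem_nhdsGT (zero_lt_one' ℝ)] with s hs l
    exact convex_Icc a b (hy l) (hz' l) (by linarith [hs.2]) hs.1.le (by ring)
  obtain ⟨s, hs0, hs⟩ := exists_seq_forall_of_frequently (hinj.and hmem).frequently
  choose α hα1 hα2 hα3 using fun q =>
    exists_sum_mul_prod_nonneg_of_injective hab h hc (hs q).1 (hs q).2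
  obtain ⟨γ, hγ, k, hk, hlim⟩ := (isCompact_sphere (0 : Fin (n + 1) → ℝ) 1).tendsto_subseq
    (x := α) (fun q => by simpa using hα1 q)
  have hs0' : Tendsto (fun q => s (k q)) atTop (𝓝 0) :=
    (tendsto_nhds_of_tendsto_nhdsWithin hs0).comp hk.tendsto_atTop
  have hXlim : ∀ l, Tendsto (fun q => X (s (k q)) l) atTop (𝓝 (y l)) := fun l => by
    have := ((hXc l).tendsto 0).comp hs0'
    rwa [hX0] at this
  have hαlim : ∀ i, Tendsto (fun q => α (k q) i) atTop (𝓝 (γ i)) := fun i =>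
    tendsto_pi_nhds.1 hlim i
  refine ⟨γ, ?_, fun l => ?_, fun t ht => ?_⟩
  · rintro rfl
    simp at hγ
  · have h1 : Tendsto (fun q => ∑ i, α (k q) i * φ i (X (s (k q)) l)) atTop
        (𝓝 (∑ i, γ i * φ i (y l))) :=
      tendsto_finsetSum _ fun i _ => (hαlim i).mul (((hc i).tendsto _).comp (hXlim l))
    refine tendsto_nhds_unique h1 ?_
    simp only [hα2]
    exact tendsto_const_nhds
  · have h1 : Tendsto (fun q => (∑ i, α (k q) i * φ i t) * ∏ l, (X (s (k q)) l - t)) atTop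
        (𝓝 ((∑ i, γ i * φ i t) * ∏ l, (y l - t))) :=
      (tendsto_finsetSum _ fun i _ => (hαlim i).mul_const _).mul
        (tendsto_finsetProd _ fun l _ => (hXlim l).sub_const _)
    exact ge_of_tendsto' h1 fun q => hα3 (k q) t ht

lemma exists_nonneg_of_endpoint {N : ℕ} {φ : Fin (2 * N + 2) → ℝ → ℝ} (hab : a < b)
    (h : IsChebyshevSystem a b φ) (hc : ∀ i, Continuous (φ i))
    {e : ℝ} (he : e = a ∨ e = b) {y : Fin N → ℝ} (hy : ∀ l, y l ∈ Set.Icc a b) :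
    ∃ α : Fin (2 * N + 2) → ℝ, α ≠ 0 ∧ ∑ i, α i * φ i e = 0 ∧
      (∀ l, ∑ i, α i * φ i (y l) = 0) ∧ ∀ t ∈ Set.Icc a b, 0 ≤ ∑ i, α i * φ i t := by
  let E : Option (Fin N ⊕ Fin N) ≃ Fin (2 * N + 1) :=
    Fintype.equivFinOfCardEq (by simp; omega)
  let Y : Option (Fin N ⊕ Fin N) → ℝ := fun o => o.elim e (Sum.elim y y)
  have hY : ∀ o, Y o ∈ Set.Icc a b := by
    rintro (_ | l | l)
    · rcases he with rfl | rfl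
      exacts [Set.left_mem_Icc.2 hab.le, Set.right_mem_Icc.2 hab.le]
    exacts [hy l, hy l]
  obtain ⟨α, hα0, hα1, hα2⟩ := h.exists_sum_mul_prod_nonneg hab hc (y := Y ∘ E.symm)
    fun l => hY _
  have hz : ∀ o, ∑ i, α i * φ i (Y o) = 0 := fun o => by simpa using hα1 (E o)
  have hprod : ∀ t, ∏ l, ((Y ∘ E.symm) l - t) = (e - t) * ∏ l, (y l - t) ^ 2 := by
    intro t
    rw [← E.prod_comp]
    simp only [Fintype.prod_option, Fintype.prod_sum_type, Y, Function.comp_apply,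
      Equiv.symm_apply_apply, Option.elim, Sum.elim_inl, Sum.elim_inr, sq, Finset.prod_mul_distrib]
  have hcases : ∀ t, t = e ∨ (∃ l, t = y l) ∨ (t ≠ e ∧ 0 < ∏ l, (y l - t) ^ 2) := by
    intro t
    by_cases h1 : t = e
    · exact Or.inl h1
    by_cases h2 : ∃ l, t = y l
    · exact Or.inr (Or.inl h2)
    refine Or.inr (Or.inr ⟨h1, Finset.prod_pos fun l _ => ?_⟩)
    have : y l - t ≠ 0 := fun h3 => h2 ⟨l, by linarith⟩
    positivity
  have h1 := hz none
  have h2 : ∀ l, ∑ i, α i * φ i (y l) = 0 := fun l => hz (some (Sum.inl l))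
  rcases he with rfl | rfl
  · refine ⟨-α, neg_ne_zero.2 hα0, ?_, ?_, ?_⟩
    · simpa [Y] using h1
    · simpa using h2
    · intro t ht
      simp only [Pi.neg_apply, neg_mul, Finset.sum_neg_distrib]
      rcases hcases t with rfl | ⟨l, rfl⟩ | ⟨h3, h4⟩
      · simpa [Y] using h1.le
      · simpa using (h2 l).le
      · have h5 := hα2 t ht
        rw [hprod, ← mul_assoc] at h5
        have h6 := nonneg_of_mul_nonneg_left h5 h4
        have h7 : e < t := lt_of_le_of_ne ht.1 (Ne.symm h3)
        by_contra h8
        nlinarith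
  · refine ⟨α, hα0, h1, h2, fun t ht => ?_⟩
    rcases hcases t with rfl | ⟨l, rfl⟩ | ⟨h3, h4⟩
    · exact h1.ge
    · exact (h2 l).ge
    · have h5 := hα2 t ht
      rw [hprod, ← mul_assoc] at h5
      have h6 := nonneg_of_mul_nonneg_left h5 h4
      exact nonneg_of_mul_nonneg_left h6 (sub_pos.2 (lt_of_le_of_ne ht.2 h3))

lemma false_of_integral_eq_sum {N : ℕ} {φ : Fin (2 * N + 2) → ℝ → ℝ} (hab : a < b)
    (h : IsChebyshevSystem a b φ) (hc : ∀ i, Continuous (φ i)) {ω : ℝ → ℝ}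
    (hω : Continuous ω) (hωpos : ∀ᵐ x ∂(volume.restrict (Set.Icc a b)), 0 < ω x)
    {ι : Type*} [Fintype ι] {x W : ι → ℝ}
    (hint : ∀ j, ∫ t in a..b, φ j t * ω t = ∑ k, φ j (x k) * W k)
    {e : ℝ} (he : e = a ∨ e = b) {y : Fin N → ℝ} (hy : ∀ l, y l ∈ Set.Icc a b)
    (hx : ∀ k, W k = 0 ∨ x k = e ∨ x k ∈ Set.range y) : False := by
  obtain ⟨α, hα0, hαe, hαy, hpos⟩ := h.exists_nonneg_of_endpoint hab hc he hy
  have hPc : Continuous fun t => ∑ i, α i * φ i t := by fun_prop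
  have h0 : ∫ t in a..b, (∑ i, α i * φ i t) * ω t = 0 := by
    calc ∫ t in a..b, (∑ i, α i * φ i t) * ω t
        = ∫ t in a..b, ∑ i, α i * (φ i t * ω t) := by
          simp only [Finset.sum_mul, mul_assoc]
      _ = ∑ i, α i * ∫ t in a..b, φ i t * ω t := by
          rw [intervalIntegral.integral_finsetSum]
          · simp only [intervalIntegral.integral_const_mul]
          · intro i _
            exact Continuous.intervalIntegrable (by fun_prop) _ _
      _ = ∑ k, (∑ i, α i * φ i (x k)) * W k := by
          simp only [hint, Finset.mul_sum, Finset.sum_mul]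
          rw [Finset.sum_comm]
          simp only [mul_assoc]
      _ = 0 := by
          refine Finset.sum_eq_zero fun k _ => ?_
          rcases hx k with h1 | h1 | ⟨l, h1⟩
          · rw [h1, mul_zero]
          · rw [h1, hαe, zero_mul]
          · rw [← h1, hαy, zero_mul]
  rw [intervalIntegral.integral_of_le hab.le, ← integral_Icc_eq_integral_Ioc,
    integral_eq_zero_iff_of_nonneg_ae] at h0
  · have h1 : (fun t => ∑ i, α i * φ i t) =ᵐ[volume.restrict (Set.Icc a b)] fun _ => 0 := by
      filter_upwards [h0, hωpos] with t ht ht'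
      exact (mul_eq_zero.1 ht).resolve_right ht'.ne'
    have h2 := Measure.eqOn_Icc_of_ae_eq volume hab.ne h1 hPc.continuousOn continuousOn_const
    exact hα0 (h.eq_zero_of_forall_Icc hab h2)
  · filter_upwards [hωpos, ae_restrict_mem measurableSet_Icc] with t ht ht'
    exact mul_nonneg (hpos t ht') ht.le
  · exact (Continuous.integrableOn_Icc (by fun_prop))

/-- A representing discrete measure with `N + 1` nodes has distinct interior nodes and
nonvanishing weights. -/
lemma nodes_of_integral_eq_sum {N : ℕ} {φ : Fin (2 * N + 2) → ℝ → ℝ} (hab : a < b)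
    (h : IsChebyshevSystem a b φ) (hc : ∀ i, Continuous (φ i)) {ω : ℝ → ℝ}
    (hω : Continuous ω) (hωpos : ∀ᵐ x ∂(volume.restrict (Set.Icc a b)), 0 < ω x)
    {x W : Fin (N + 1) → ℝ} (hx : ∀ k, x k ∈ Set.Icc a b)
    (hint : ∀ j, ∫ t in a..b, φ j t * ω t = ∑ k, φ j (x k) * W k) :
    Function.Injective x ∧ (∀ k, x k ∈ Set.Ioo a b) ∧ ∀ k, W k ≠ 0 := by
  have key : ∀ k₀ : Fin (N + 1), ∀ e, (e = a ∨ e = b) →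
      ¬ (W k₀ = 0 ∨ x k₀ = e ∨ x k₀ ∈ Set.range (x ∘ k₀.succAbove)) := by
    intro k₀ e he hk₀
    refine h.false_of_integral_eq_sum hab hc hω hωpos hint he
      (y := x ∘ k₀.succAbove) (fun l => hx _) fun k => ?_
    by_cases hk : k = k₀
    · rwa [hk]
    · obtain ⟨l, rfl⟩ := Fin.exists_succAbove_eq hk
      exact Or.inr (Or.inr ⟨l, rfl⟩)
  refine ⟨fun k l hkl => ?_, fun k => ⟨?_, ?_⟩, fun k hk => key k a (Or.inl rfl) (Or.inl hk)⟩
  · by_contra hne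
    obtain ⟨m, rfl⟩ := Fin.exists_succAbove_eq hne
    exact key l a (Or.inl rfl) (Or.inr (Or.inr ⟨m, hkl⟩))
  · exact lt_of_le_of_ne (hx k).1 fun h1 => key k a (Or.inl rfl) (Or.inr (Or.inl h1.symm))
  · exact lt_of_le_of_ne (hx k).2 fun h1 => key k b (Or.inr rfl) (Or.inr (Or.inl h1))

lemma sum_image_fiber {ι : Type*} [Fintype ι] (x : ι → ℝ) (W : ι → ℝ) (g : ℝ → ℝ)
    (Z : Finset ℝ) (hZ : ∀ k, x k ∈ Z) :
    ∑ z ∈ Z, (∑ k with x k = z, W k) * g z = ∑ k, W k * g (x k) := by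
  rw [← Finset.sum_fiberwise_of_maps_to (t := Z) (g := x) fun k _ => hZ k]
  refine Finset.sum_congr rfl fun z _ => ?_
  rw [Finset.sum_mul]
  exact Finset.sum_congr rfl fun k hk => by rw [(Finset.mem_filter.1 hk).2]

lemma quadrature_unique {n : ℕ} {φ : Fin n → ℝ → ℝ} (hab : a < b)
    (h : IsChebyshevSystem a b φ) {m : ℕ} (hm : m + m ≤ n) {x x' w w' : Fin m → ℝ}
    (hx : StrictMono x) (hx' : StrictMono x') (hxm : ∀ k, x k ∈ Set.Icc a b)
    (hxm' : ∀ k, x' k ∈ Set.Icc a b) (hw : ∀ k, w k ≠ 0) (hw' : ∀ k, w' k ≠ 0)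
    (heq : ∀ j, ∑ k, φ j (x k) * w k = ∑ k, φ j (x' k) * w' k) : x = x' ∧ w = w' := by
  classical
  set Z : Finset ℝ := Finset.univ.image x ∪ Finset.univ.image x' with hZ
  have hxZ : ∀ k, x k ∈ Z := fun k => by simp [hZ]
  have hxZ' : ∀ k, x' k ∈ Z := fun k => by simp [hZ]
  have hZm : ∀ z ∈ Z, z ∈ Set.Icc a b := by
    intro z hz
    simp only [hZ, Finset.mem_union, Finset.mem_image, Finset.mem_univ, true_and] at hz
    rcases hz with ⟨k, rfl⟩ | ⟨k, rfl⟩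
    exacts [hxm k, hxm' k]
  have hcard : Z.card ≤ n := by
    refine (Finset.card_union_le _ _).trans (le_trans (add_le_add Finset.card_image_le
      Finset.card_image_le) ?_)
    simpa using hm
  have key := h.eq_zero_of_sum_eq_zero hab hZm hcard
    (f := fun z => (∑ k with x k = z, w k) - ∑ k with x' k = z, w' k) fun j => by
      simp only [sub_mul, Finset.sum_sub_distrib]
      rw [sum_image_fiber x w _ Z hxZ, sum_image_fiber x' w' _ Z hxZ']
      simp only [mul_comm (w _), mul_comm (w' _)]
      exact sub_eq_zero.2 (heq j)
  have hfib : ∀ k, ∑ l with x l = x k, w l = w k := by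
    intro k
    have : Finset.univ.filter (fun l => x l = x k) = {k} := by
      ext l
      simp [hx.injective.eq_iff]
    rw [this, Finset.sum_singleton]
  have hfib' : ∀ k, ∑ l with x' l = x' k, w' l = w' k := by
    intro k
    have : Finset.univ.filter (fun l => x' l = x' k) = {k} := by
      ext l
      simp [hx'.injective.eq_iff]
    rw [this, Finset.sum_singleton]
  have hsub : ∀ k, x k ∈ Set.range x' := by
    intro k
    by_contra hk
    have h1 := key _ (hxZ k)
    have h2 : ∑ l with x' l = x k, w' l = 0 := by
      rw [Finset.filter_false_of_mem (fun l _ hl => hk ⟨l, hl⟩), Finset.sum_empty]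
    simp only [hfib, h2, sub_zero] at h1
    exact hw k h1
  have hsub' : ∀ k, x' k ∈ Set.range x := by
    intro k
    by_contra hk
    have h1 := key _ (hxZ' k)
    have h2 : ∑ l with x l = x' k, w l = 0 := by
      rw [Finset.filter_false_of_mem (fun l _ hl => hk ⟨l, hl⟩), Finset.sum_empty]
    simp only [hfib', h2, zero_sub, neg_eq_zero] at h1
    exact hw' k h1
  have hxx : x = x' := by
    refine (StrictMono.range_inj hx hx').1 (Set.Subset.antisymm ?_ ?_)
    · rintro _ ⟨k, rfl⟩
      exact hsub k
    · rintro _ ⟨k, rfl⟩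
      exact hsub' k
  subst hxx
  refine ⟨rfl, funext fun k => ?_⟩
  have := key _ (hxZ k)
  simp only [hfib, hfib'] at this
  exact sub_eq_zero.1 this

lemma exists_separated_or_cover (n : ℕ) (S : Finset ℕ) :
    (∃ s : Fin (n + 1) → ℕ, (∀ k, s k ∈ S) ∧ ∀ k l, k < l → s k + 2 ≤ s l) ∨
      ∃ p : Fin n → ℕ, ∀ i ∈ S, ∃ k, i = p k ∨ i = p k + 1 := by
  induction n generalizing S with
  | zero =>
    rcases S.eq_empty_or_nonempty with rfl | ⟨m, hm⟩
    · exact Or.inr ⟨Fin.elim0, by simp⟩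
    · exact Or.inl ⟨fun _ => m, fun _ => hm, fun k l hkl => by omega⟩
  | succ n ih =>
    rcases S.eq_empty_or_nonempty with rfl | hne
    · exact Or.inr ⟨fun _ => 0, by simp⟩
    set m := S.min' hne with hm
    rcases ih (S.filter fun i => m + 2 ≤ i) with ⟨s, hs, hsep⟩ | ⟨p, hp⟩
    · refine Or.inl ⟨Fin.cons m s, ?_, ?_⟩
      · refine Fin.cases (by simpa using S.min'_mem hne) fun k => ?_
        simpa using (Finset.mem_filter.1 (hs k)).1
      · intro k l hkl
        induction l using Fin.cases with
        | zero => exact absurd hkl (Fin.not_lt_zero k)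
        | succ l =>
          induction k using Fin.cases with
          | zero => simpa using (Finset.mem_filter.1 (hs l)).2
          | succ k => simpa using hsep k l (Fin.succ_lt_succ_iff.1 hkl)
    · refine Or.inr ⟨Fin.cons m p, fun i hi => ?_⟩
      by_cases him : m + 2 ≤ i
      · obtain ⟨k, hk⟩ := hp i (Finset.mem_filter.2 ⟨hi, him⟩)
        exact ⟨k.succ, by simpa using hk⟩
      · have := S.min'_le i hi
        refine ⟨0, ?_⟩
        simp only [Fin.cons_zero]
        omega

/-- Positive weights making finitely many vectors with positive last coefficient positive. -/
lemma exists_pos_weights {M n : ℕ} (v : (Fin (n + 1) → Fin M) → Fin (n + 1) → ℝ)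
    (hv : ∀ f, StrictMono f → 0 < v f (Fin.last n)) :
    ∃ Φ : Fin M → ℝ, (∀ i, 0 < Φ i) ∧ ∀ f, StrictMono f → 0 < ∑ l, v f l * Φ (f l) := by
  have h1 : ∀ᶠ ε in 𝓝[>] (0 : ℝ), ∀ f : Fin (n + 1) → Fin M, StrictMono f →
      0 < ∑ l, v f l * ε ^ ((f (Fin.last n) : ℕ) - (f l : ℕ)) := by
    rw [Filter.eventually_all]
    intro f
    by_cases hf : StrictMono f
    · have hcont : Continuous fun ε : ℝ =>
          ∑ l, v f l * ε ^ ((f (Fin.last n) : ℕ) - (f l : ℕ)) := by fun_prop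
      have h0 : 0 < ∑ l, v f l * (0 : ℝ) ^ ((f (Fin.last n) : ℕ) - (f l : ℕ)) := by
        rw [Finset.sum_eq_single (Fin.last n)]
        · simpa using hv f hf
        · intro l _ hl
          have : (f l : ℕ) < f (Fin.last n) := hf (lt_of_le_of_ne (Fin.le_last l) hl)
          rw [zero_pow (by omega), mul_zero]
        · simp
      have := hcont.continuousAt.eventually (lt_mem_nhds h0)
      filter_upwards [nhdsWithin_le_nhds this] with ε hε _ using hε
    · exact Filter.Eventually.of_forall fun ε h => (hf h).elim
  obtain ⟨ε, hε, hε0⟩ := (h1.and self_mem_nhdsWithin).exists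
  have hε0 : 0 < ε := hε0
  refine ⟨fun i => ε ^ (M - (i : ℕ)), fun i => by positivity, fun f hf => ?_⟩
  have : ∑ l, v f l * ε ^ (M - (f l : ℕ)) = ε ^ (M - (f (Fin.last n) : ℕ)) *
      ∑ l, v f l * ε ^ ((f (Fin.last n) : ℕ) - (f l : ℕ)) := by
    rw [Finset.mul_sum]
    refine Finset.sum_congr rfl fun l _ => ?_
    have h2 : (f l : ℕ) ≤ f (Fin.last n) := hf.monotone (Fin.le_last l)
    have h3 := (f (Fin.last n)).2
    rw [mul_left_comm, ← pow_add]
    congr 2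
    omega
  rw [this]
  exact mul_pos (by positivity) (hε f hf)

/-- A linear program with positive objective has a minimizer, and no feasible descent
direction exists there. -/
lemma exists_minimizer {M n : ℕ} (u : Fin M → Fin n → ℝ) (Φ : Fin M → ℝ) (hΦ : ∀ i, 0 < Φ i)
    (w₀ : Fin M → ℝ) (hw₀ : ∀ i, 0 ≤ w₀ i) :
    ∃ w : Fin M → ℝ, (∀ i, 0 ≤ w i) ∧ (∀ j, ∑ i, w i * u i j = ∑ i, w₀ i * u i j) ∧
      ∀ d : Fin M → ℝ, (∀ j, ∑ i, d i * u i j = 0) → (∀ i, 0 < d i → 0 < w i) →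
        ∑ i, d i * Φ i ≤ 0 := by
  set A : Set (Fin M → ℝ) := {w | (∀ i, 0 ≤ w i) ∧
    (∀ j, ∑ i, w i * u i j = ∑ i, w₀ i * u i j) ∧ ∑ i, w i * Φ i ≤ ∑ i, w₀ i * Φ i} with hA
  have hclosed : IsClosed A := by
    simp only [hA, Set.ofPred_and, Set.ofPred_forall]
    refine IsClosed.inter (isClosed_iInter fun i => isClosed_le (by fun_prop) (by fun_prop))
      (IsClosed.inter (isClosed_iInter fun i => isClosed_eq (by fun_prop) (by fun_prop))
        (isClosed_le (by fun_prop) (by fun_prop)))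
  have hsub : A ⊆ Set.Icc 0 fun i => (∑ i, w₀ i * Φ i) / Φ i := by
    rintro w ⟨h1, -, h2⟩
    refine ⟨h1, fun i => ?_⟩
    rw [le_div_iff₀ (hΦ i)]
    exact (Finset.single_le_sum (f := fun i => w i * Φ i)
      (fun i _ => mul_nonneg (h1 i) (hΦ i).le) (Finset.mem_univ i)).trans h2
  have hcomp : IsCompact A := isCompact_Icc.of_isClosed_subset hclosed hsub
  obtain ⟨w, hwA, hwmin⟩ := hcomp.exists_isMinOn ⟨w₀, hw₀, fun _ => rfl, le_rfl⟩
    (f := fun w => ∑ i, w i * Φ i) (by fun_prop)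
  obtain ⟨h1, h2, h3⟩ := hwA
  refine ⟨w, h1, h2, fun d hd hdw => ?_⟩
  by_contra! hneg
  have hθ : ∀ᶠ θ in 𝓝[>] (0 : ℝ), ∀ i, θ * d i ≤ w i := by
    rw [Filter.eventually_all]
    intro i
    rcases le_or_gt (d i) 0 with hdi | hdi
    · filter_upwards [self_mem_nhdsWithin] with θ hθ
      exact (mul_nonpos_of_nonneg_of_nonpos (le_of_lt hθ) hdi).trans (h1 i)
    · have hcont : Continuous fun θ : ℝ => θ * d i := by fun_prop
      have : ∀ᶠ θ in 𝓝 (0 : ℝ), θ * d i < w i :=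
        hcont.continuousAt.eventually (gt_mem_nhds (by simpa using hdw i hdi))
      filter_upwards [nhdsWithin_le_nhds this] with θ hθ using hθ.le
  obtain ⟨θ, hθ, hθ0⟩ := (hθ.and self_mem_nhdsWithin).exists
  have hθ0 : 0 < θ := hθ0
  have e : ∀ g : Fin M → ℝ, ∑ i, (w i - θ * d i) * g i
      = ∑ i, w i * g i - θ * ∑ i, d i * g i := by
    intro g
    rw [Finset.mul_sum, ← Finset.sum_sub_distrib]
    exact Finset.sum_congr rfl fun i _ => by ring
  have hlt : ∑ i, (w i - θ * d i) * Φ i < ∑ i, w i * Φ i := by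
    rw [e]
    linarith [mul_pos hθ0 hneg]
  have hmem : (fun i => w i - θ * d i) ∈ A :=
    ⟨fun i => sub_nonneg.2 (hθ i), fun j => by rw [e, hd, mul_zero, sub_zero, h2 j],
      hlt.le.trans h3⟩
  exact absurd (hwmin hmem) (not_le.2 hlt)

/-- A nonnegative combination of values on a grid can be rewritten so that it is
carried by `N + 1` pairs of neighbouring grid points. -/
lemma exists_paired_weights {N : ℕ} {φ : Fin (2 * N + 2) → ℝ → ℝ}
    (h : IsChebyshevSystem a b φ) (hc : ∀ i, Continuous (φ i)) {M : ℕ} {τ : Fin M → ℝ}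
    (hτ : StrictMono τ) (hτ' : ∀ i, τ i ∈ Set.Icc a b) (w₀ : Fin M → ℝ)
    (hw₀ : ∀ i, 0 ≤ w₀ i) :
    ∃ w : Fin M → ℝ, (∀ i, 0 ≤ w i) ∧ (∀ j, ∑ i, w i * φ j (τ i) = ∑ i, w₀ i * φ j (τ i)) ∧
      ∃ p : Fin (N + 1) → ℕ, ∀ i, w i ≠ 0 → ∃ k, (i : ℕ) = p k ∨ (i : ℕ) = p k + 1 := by
  have hrel : ∀ f : Fin (2 * N + 2 + 1) → Fin M, ∃ v : Fin (2 * N + 2 + 1) → ℝ,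
      StrictMono f → (∀ l : Fin (2 * N + 2 + 1), 0 < (-1) ^ (l : ℕ) * v l) ∧
        ∀ j, ∑ l, v l * φ j (τ (f l)) = 0 := by
    intro f
    by_cases hf : StrictMono f
    · obtain ⟨v, hv⟩ := h.exists_alternating_relation hc (hτ.comp hf) fun i => hτ' _
      exact ⟨v, fun _ => hv⟩
    · exact ⟨0, fun h' => (hf h').elim⟩
  choose v hv using hrel
  obtain ⟨Φ, hΦ, hΦv⟩ := exists_pos_weights v fun f hf => by
    have := (hv f hf).1 (Fin.last _)
    rwa [Fin.val_last, Even.neg_one_pow ⟨N + 1, by ring⟩, one_mul] at this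
  obtain ⟨w, hw, hw', hmin⟩ := exists_minimizer (fun i j => φ j (τ i)) Φ hΦ w₀ hw₀
  refine ⟨w, hw, hw', ?_⟩
  rcases exists_separated_or_cover (N + 1) ((Finset.univ.filter fun i => w i ≠ 0).map
    Fin.valEmbedding) with ⟨s, hs, hsep⟩ | ⟨p, hp⟩
  · exfalso
    have hsM : ∀ k, ∃ hk : s k < M, w ⟨s k, hk⟩ ≠ 0 := by
      intro k
      obtain ⟨i, hi, hik⟩ := Finset.mem_map.1 (hs k)
      have hik : (i : ℕ) = s k := hik
      refine ⟨hik ▸ i.2, ?_⟩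
      have : (⟨s k, hik ▸ i.2⟩ : Fin M) = i := Fin.ext hik.symm
      rw [this]
      exact (Finset.mem_filter.1 hi).2
    let g : Fin (2 * N + 2 + 1) → ℕ := fun l => s ⟨l / 2, by omega⟩ + l % 2
    have hgM : ∀ l, g l < M := by
      intro l
      rcases Nat.mod_two_eq_zero_or_one l with hl | hl
      · simpa [g, hl] using (hsM ⟨l / 2, by omega⟩).1
      · have h1 := hsep ⟨l / 2, by omega⟩ ⟨l / 2 + 1, by omega⟩ (Fin.mk_lt_mk.2 (by omega))
        have h2 := (hsM ⟨l / 2 + 1, by omega⟩).1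
        simp only [g]
        omega
    let f : Fin (2 * N + 2 + 1) → Fin M := fun l => ⟨g l, hgM l⟩
    have hf : StrictMono f := by
      intro l m hlm
      change s ⟨l / 2, by omega⟩ + l % 2 < s ⟨m / 2, by omega⟩ + m % 2
      have hlm : (l : ℕ) < m := hlm
      rcases (Nat.div_le_div_right (c := 2) hlm.le).eq_or_lt with h1 | h1
      · simp only [h1]
        omega
      · have := hsep ⟨l / 2, by omega⟩ ⟨m / 2, by omega⟩ (Fin.mk_lt_mk.2 h1)
        omega
    obtain ⟨hv1, hv2⟩ := hv f hf
    have hd : ∀ G : Fin M → ℝ, ∑ i, (∑ l, if f l = i then v f l else 0) * G i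
        = ∑ l, v f l * G (f l) := by
      intro G
      simp only [Finset.sum_mul]
      rw [Finset.sum_comm]
      refine Finset.sum_congr rfl fun l _ => ?_
      simp [ite_mul]
    have h3 := hmin (fun i => ∑ l, if f l = i then v f l else 0)
      (fun j => by rw [hd]; exact hv2 j) fun i hi => ?_
    · rw [hd] at h3
      exact absurd h3 (not_le.2 (hΦv f hf))
    · obtain ⟨l, -, hl⟩ := Finset.exists_ne_zero_of_sum_ne_zero hi.ne'
      obtain rfl : f l = i := by
        by_contra hne
        exact hl (if_neg hne)
      simp only [hf.injective.eq_iff, Finset.sum_ite_eq', Finset.mem_univ, if_true] at hi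
      rcases Nat.mod_two_eq_zero_or_one l with hl2 | hl2
      · refine lt_of_le_of_ne (hw _) (Ne.symm ?_)
        have : f l = ⟨s ⟨l / 2, by omega⟩, (hsM _).1⟩ := Fin.ext (by simp [f, g, hl2])
        rw [this]
        exact (hsM _).2
      · have := hv1 l
        rw [Odd.neg_one_pow (Nat.odd_iff.2 hl2)] at this
        linarith
  · exact ⟨p, fun i hi => hp i (Finset.mem_map.2 ⟨i, by simpa using hi, rfl⟩)⟩

lemma exists_modulus {n : ℕ} {φ : Fin n → ℝ → ℝ} (hc : ∀ i, Continuous (φ i)) (a b : ℝ)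
    {η : ℝ} (hη : 0 < η) :
    ∃ δ > 0, ∀ s ∈ Set.Icc a b, ∀ t ∈ Set.Icc a b, |s - t| < δ →
      ∀ j, |φ j s - φ j t| ≤ η := by
  have hu : Continuous fun t j => φ j t := continuous_pi hc
  obtain ⟨δ, hδ, h⟩ := Metric.uniformContinuousOn_iff.1
    (isCompact_Icc.uniformContinuousOn_of_continuous (hu.continuousOn (s := Set.Icc a b))) η hη
  exact ⟨δ, hδ, fun s hs t ht hst j => (dist_le_pi_dist _ _ j).trans (h s hs t ht hst).le⟩

lemma abs_integral_sub_sum_le {f ω : ℝ → ℝ} {M : ℕ} {t : ℕ → ℝ} (ht : Monotone t)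
    (hf : Continuous f) (hω : Continuous ω)
    (hω0 : ∀ x ∈ Set.Icc (t 0) (t M), 0 ≤ ω x) {η : ℝ}
    (hη : ∀ i < M, ∀ x ∈ Set.Icc (t i) (t (i + 1)), |f x - f (t i)| ≤ η) :
    |(∫ x in t 0..t M, f x * ω x) - ∑ i ∈ Finset.range M, (∫ x in t i..t (i + 1), ω x) * f (t i)|
      ≤ η * ∫ x in t 0..t M, ω x := by
  have hint : ∀ g : ℝ → ℝ, Continuous g → ∀ c d, IntervalIntegrable g volume c d :=
    fun g hg c d => hg.intervalIntegrable c d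
  rw [← intervalIntegral.sum_integral_adjacent_intervals fun i _ => hint _ (by fun_prop) _ _,
    ← intervalIntegral.sum_integral_adjacent_intervals fun i _ => hint _ hω _ _,
    ← Finset.sum_sub_distrib, Finset.mul_sum]
  refine (Finset.abs_sum_le_sum_abs _ _).trans (Finset.sum_le_sum fun i hi => ?_)
  have hiM := Finset.mem_range.1 hi
  have hle : t i ≤ t (i + 1) := ht (Nat.le_succ i)
  rw [mul_comm (∫ x in t i..t (i + 1), ω x), ← intervalIntegral.integral_const_mul,
    ← intervalIntegral.integral_const_mul,
    ← intervalIntegral.integral_sub (hint _ (by fun_prop) _ _) (hint _ (by fun_prop) _ _)]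
  refine (intervalIntegral.abs_integral_le_integral_abs hle).trans
    (intervalIntegral.integral_mono_on hle (hint _ (by fun_prop) _ _)
      (hint _ (by fun_prop) _ _) fun x hx => ?_)
  have hx0 : 0 ≤ ω x := hω0 x ⟨(ht (Nat.zero_le i)).trans hx.1, hx.2.trans (ht hiM)⟩
  rw [← sub_mul, abs_mul, abs_of_nonneg hx0]
  exact mul_le_mul_of_nonneg_right (hη i hiM x hx) hx0

/-- Approximate quadrature with `N + 1` nodes. -/
lemma exists_approximate_quadrature {N : ℕ} {φ : Fin (2 * N + 2) → ℝ → ℝ} (hab : a < b)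
    (h : IsChebyshevSystem a b φ) (hc : ∀ i, Continuous (φ i)) {ω : ℝ → ℝ}
    (hω : Continuous ω) (hω0 : ∀ x ∈ Set.Icc a b, 0 ≤ ω x) {η : ℝ} (hη : 0 < η) :
    ∃ y W : Fin (N + 1) → ℝ, (∀ k, y k ∈ Set.Icc a b) ∧ (∀ k, 0 ≤ W k) ∧
      ∀ j, |(∫ x in a..b, φ j x * ω x) - ∑ k, W k * φ j (y k)|
        ≤ η * ((∫ x in a..b, ω x) + ∑ k, W k) := by
  classical
  obtain ⟨δ, hδ, hmod⟩ := exists_modulus hc a b hη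
  obtain ⟨M, hM⟩ := exists_nat_gt ((b - a) / δ)
  have hM0 : (0 : ℝ) < M := lt_of_le_of_lt (div_nonneg (by linarith) hδ.le) hM
  set r := (b - a) / M with hr
  have hr0 : 0 < r := div_pos (by linarith) hM0
  have hrδ : r < δ := by
    rw [hr, div_lt_iff₀ hM0]
    rwa [div_lt_iff₀ hδ, mul_comm] at hM
  set t : ℕ → ℝ := fun i => a + i * r with ht
  have htm : StrictMono t := fun i j hij => by
    have : (i : ℝ) < j := by exact_mod_cast hij
    simp only [ht]
    nlinarith
  have ht0 : t 0 = a := by simp [ht]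
  have htM : t M = b := by
    simp only [ht, hr]
    field_simp
    ring
  have hts : ∀ i, t (i + 1) = t i + r := fun i => by
    simp only [ht]
    push_cast
    ring
  have hta : ∀ i, a ≤ t i := fun i => ht0 ▸ htm.monotone (Nat.zero_le i)
  have htb : ∀ i ≤ M, t i ≤ b := fun i hi => htM ▸ htm.monotone hi
  have hRiem : ∀ j, |(∫ x in a..b, φ j x * ω x)
      - ∑ i : Fin M, (∫ x in t i..t (i + 1), ω x) * φ j (t i)| ≤ η * ∫ x in a..b, ω x := by
    intro j
    rw [Fin.sum_univ_eq_sum_range (fun i => (∫ x in t i..t (i + 1), ω x) * φ j (t i)) M]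
    have := abs_integral_sub_sum_le (M := M) (η := η) htm.monotone (hc j) hω
      (by rwa [ht0, htM]) fun i hi x hx => hmod x ⟨(hta i).trans hx.1, hx.2.trans (htb _ hi)⟩
        (t i) ⟨hta i, htb i hi.le⟩ (by
          rw [abs_of_nonneg (sub_nonneg.2 hx.1)]
          linarith [hx.2, hts i]) j
    rwa [ht0, htM] at this
  obtain ⟨w, hw, hw', p, hp⟩ := h.exists_paired_weights hc (τ := fun i : Fin M => t i)
    (fun i k hik => htm hik) (fun i => ⟨hta i, htb i i.2.le⟩)
    (fun i : Fin M => ∫ x in t i..t (i + 1), ω x) fun i =>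
      intervalIntegral.integral_nonneg (htm.monotone (Nat.le_succ _)) fun x hx =>
        hω0 x ⟨(hta i).trans hx.1, hx.2.trans (htb _ i.2)⟩
  have hq : ∀ i, ∃ k, w i ≠ 0 → (i : ℕ) = p k ∨ (i : ℕ) = p k + 1 := by
    intro i
    by_cases hi : w i = 0
    · exact ⟨0, fun h => (h hi).elim⟩
    · obtain ⟨k, hk⟩ := hp i hi
      exact ⟨k, fun _ => hk⟩
  choose q hq using hq
  set y : Fin (N + 1) → ℝ := fun k => min b (t (p k)) with hy
  have hyI : ∀ k, y k ∈ Set.Icc a b := fun k => ⟨le_min hab.le (hta _), min_le_left _ _⟩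
  have hfib : ∀ g : Fin (N + 1) → ℝ, ∑ k, (∑ i with q i = k, w i) * g k = ∑ i, w i * g (q i) := by
    intro g
    rw [← Finset.sum_fiberwise (s := Finset.univ) (g := q)]
    refine Finset.sum_congr rfl fun k _ => ?_
    rw [Finset.sum_mul]
    exact Finset.sum_congr rfl fun i hi => by rw [(Finset.mem_filter.1 hi).2]
  refine ⟨y, fun k => ∑ i with q i = k, w i, hyI, fun k => Finset.sum_nonneg fun i _ => hw i,
    fun j => ?_⟩
  have hsum : ∑ k, ∑ i with q i = k, w i = ∑ i, w i := by simpa using hfib fun _ => 1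
  have hmove : |∑ i, w i * φ j (t i) - ∑ i, w i * φ j (y (q i))| ≤ η * ∑ i, w i := by
    rw [← Finset.sum_sub_distrib, Finset.mul_sum]
    refine (Finset.abs_sum_le_sum_abs _ _).trans (Finset.sum_le_sum fun i _ => ?_)
    by_cases hi : w i = 0
    · simp [hi]
    · rw [← mul_sub, abs_mul, abs_of_nonneg (hw i), mul_comm]
      refine mul_le_mul_of_nonneg_right (hmod _ ⟨hta i, htb i i.2.le⟩ _ (hyI _) ?_ j) (hw i)
      have hib := htb i i.2.le
      rcases hq i hi with h1 | h1
      · rw [h1] at hib ⊢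
        simp only [hy, min_eq_right hib, sub_self, abs_zero]
        exact hδ
      · rw [h1, hts] at hib ⊢
        simp only [hy, min_eq_right (show t (p (q i)) ≤ b by linarith)]
        rw [add_sub_cancel_left, abs_of_pos hr0]
        exact hrδ
  rw [hfib fun k => φ j (y k), hsum, mul_add]
  have h1 := hRiem j
  rw [← hw' j] at h1
  exact (abs_sub_le _ _ _).trans (add_le_add h1 hmove)

lemma exists_nonneg_quadrature {N : ℕ} {φ : Fin (2 * N + 2) → ℝ → ℝ} (hab : a < b)
    (h : IsChebyshevSystem a b φ) (hc : ∀ i, Continuous (φ i)) {ω : ℝ → ℝ}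
    (hω : Continuous ω) (hω0 : ∀ x ∈ Set.Icc a b, 0 ≤ ω x) :
    ∃ y W : Fin (N + 1) → ℝ, (∀ k, y k ∈ Set.Icc a b) ∧ (∀ k, 0 ≤ W k) ∧
      ∀ j, ∫ x in a..b, φ j x * ω x = ∑ k, φ j (y k) * W k := by
  classical
  set c : Fin (2 * N + 2) → ℝ := fun j => ∫ x in a..b, φ j x * ω x with hcdef
  have hC : 0 ≤ ∫ x in a..b, ω x := intervalIntegral.integral_nonneg hab.le hω0
  let K : Set (ℝ × (Fin (N + 1) → ℝ) × (Fin (N + 1) → ℝ)) :=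
    {p | 0 ≤ p.1 ∧ (∀ k, 0 ≤ p.2.1 k) ∧ p.1 + ∑ k, p.2.1 k = 1 ∧
      (∀ k, a ≤ p.2.2 k) ∧ ∀ k, p.2.2 k ≤ b}
  let F : ℝ × (Fin (N + 1) → ℝ) × (Fin (N + 1) → ℝ) → Fin (2 * N + 2) → ℝ :=
    fun p j => p.1 * c j - ∑ k, p.2.1 k * φ j (p.2.2 k)
  have hKclosed : IsClosed K := by
    simp only [K, Set.ofPred_and, Set.ofPred_forall]
    refine IsClosed.inter (isClosed_le (by fun_prop) (by fun_prop)) (IsClosed.inter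
      (isClosed_iInter fun i => isClosed_le (by fun_prop) (by fun_prop)) (IsClosed.inter
      (isClosed_eq (by fun_prop) (by fun_prop)) (IsClosed.inter
      (isClosed_iInter fun i => isClosed_le (by fun_prop) (by fun_prop))
      (isClosed_iInter fun i => isClosed_le (by fun_prop) (by fun_prop)))))
  have hKsub : K ⊆ Set.Icc (0, 0, fun _ => a) (1, 1, fun _ => b) := by
    rintro ⟨s, V, y⟩ ⟨h1, h2, h3, h4, h5⟩
    simp only at h1 h2 h3 h4 h5
    have h6 := Finset.sum_nonneg fun k (_ : k ∈ Finset.univ) => h2 k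
    refine ⟨⟨h1, h2, h4⟩, ⟨by simp only; linarith, fun k => ?_, h5⟩⟩
    have := Finset.single_le_sum (fun k _ => h2 k) (Finset.mem_univ k)
    simp only [Pi.one_apply]
    linarith
  have hKcomp : IsCompact K := isCompact_Icc.of_isClosed_subset hKclosed hKsub
  have hFc : Continuous F := by
    refine continuous_pi fun j => ?_
    have := hc j
    fun_prop
  have happrox : ∀ η > 0, ∃ p ∈ K, ‖F p‖ ≤ η := by
    intro η hη
    obtain ⟨y, W, hy, hW, hyW⟩ := h.exists_approximate_quadrature hab hc hω hω0
      (η := η / (1 + ∫ x in a..b, ω x)) (by positivity)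
    have hS : 0 ≤ ∑ k, W k := Finset.sum_nonneg fun k _ => hW k
    have hS1 : 0 < 1 + ∑ k, W k := by linarith
    refine ⟨((1 + ∑ k, W k)⁻¹, fun k => (1 + ∑ k, W k)⁻¹ * W k, y), ⟨by positivity,
      fun k => mul_nonneg (by positivity) (hW k), ?_, fun k => (hy k).1, fun k => (hy k).2⟩, ?_⟩
    · simp only [← Finset.mul_sum]
      field_simp
    · refine (pi_norm_le_iff_of_nonneg hη.le).2 fun j => ?_
      have e : F ((1 + ∑ k, W k)⁻¹, fun k => (1 + ∑ k, W k)⁻¹ * W k, y) j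
          = (1 + ∑ k, W k)⁻¹ * (c j - ∑ k, W k * φ j (y k)) := by
        simp only [F, mul_sub, Finset.mul_sum, mul_assoc]
      rw [e, Real.norm_eq_abs, abs_mul, abs_of_pos (inv_pos.2 hS1), inv_mul_le_iff₀ hS1]
      refine (hyW j).trans ?_
      rw [div_mul_eq_mul_div, div_le_iff₀ (by linarith)]
      nlinarith [mul_nonneg hη.le (mul_nonneg hC hS)]
  obtain ⟨p₀, hp₀, -⟩ := happrox 1 one_pos
  obtain ⟨⟨s, V, y⟩, ⟨hs, hV, hsV, hya, hyb⟩, hmin⟩ := hKcomp.exists_isMinOn ⟨p₀, hp₀⟩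
    hFc.norm.continuousOn
  simp only at hs hV hsV hya hyb
  have hF0 : F (s, V, y) = 0 := by
    rw [← norm_le_zero_iff]
    refine le_of_forall_pos_le_add fun η hη => ?_
    obtain ⟨p, hp, hpη⟩ := happrox η hη
    rw [zero_add]
    exact (hmin hp).trans hpη
  have hF : ∀ j, s * c j = ∑ k, V k * φ j (y k) := fun j => sub_eq_zero.1 (congrFun hF0 j)
  have hyI : ∀ k, y k ∈ Set.Icc a b := fun k => ⟨hya k, hyb k⟩
  rcases hs.eq_or_lt with rfl | hs
  · exfalso
    have hmem : ∀ k, y k ∈ Finset.univ.image y := fun k => by simp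
    have key := h.eq_zero_of_sum_eq_zero hab (Z := Finset.univ.image y)
      (f := fun z => ∑ k with y k = z, V k) (fun z hz => by
        obtain ⟨k, -, rfl⟩ := Finset.mem_image.1 hz
        exact hyI k)
      (Finset.card_image_le.trans (by simp; omega))
      (fun j => by rw [sum_image_fiber y V _ _ hmem, ← hF, zero_mul])
    have : ∑ k, V k = 0 := by
      have h1 := sum_image_fiber y V (fun _ => 1) _ hmem
      simp only [mul_one] at h1
      rw [← h1]
      exact Finset.sum_eq_zero key
    linarith
  · refine ⟨y, fun k => V k / s, hyI, fun k => div_nonneg (hV k) hs.le, fun j => ?_⟩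
    have h1 := hF j
    calc c j = (s * c j) / s := by field_simp
      _ = _ := by
        rw [h1, Finset.sum_div]
        exact Finset.sum_congr rfl fun k _ => by ring

end IsChebyshevSystem

theorem generalized_gauss_quadrature_chebyshev
    (a b : ℝ) (hab : a < b) (N : ℕ) (ω : ℝ → ℝ)
    (hω : ContinuousOn ω (Set.Icc a b))
    (hωpos : ∀ᵐ x ∂(volume.restrict (Set.Icc a b)), 0 < ω x)
    (φ : Fin (2 * N + 2) → ℝ → ℝ)
    (hcheb : IsChebyshevSystem a b φ) :
    ∃! p : (Fin (N + 1) → ℝ) × (Fin (N + 1) → ℝ),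
      StrictMono p.1 ∧ (∀ k, p.1 k ∈ Set.Ioo a b) ∧ (∀ k, 0 < p.2 k) ∧
      ∀ j, ∫ x in a..b, φ j x * ω x = ∑ k, φ j (p.1 k) * p.2 k := by
  let extend (f : ℝ → ℝ) : ℝ → ℝ := Set.IccExtend hab.le ((Set.Icc a b).domRestrict f)
  have hext : ∀ f, ∀ x ∈ Set.Icc a b, extend f x = f x := fun f x hx =>
    Set.IccExtend_of_mem hab.le _ hx
  have hextc : ∀ f, ContinuousOn f (Set.Icc a b) → Continuous (extend f) := fun f hf =>
    hf.domRestrict.Icc_extend'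
  have hc : ∀ i, Continuous (extend (φ i)) := fun i => hextc _ (hcheb.1 i)
  have hωc : Continuous (extend ω) := hextc _ hω
  have hch : IsChebyshevSystem a b fun i => extend (φ i) := by
    refine ⟨fun i => (hc i).continuousOn, fun x hx hinj => ?_⟩
    have e : (Matrix.of fun i j => extend (φ i) (x j)) = Matrix.of fun i j => φ i (x j) := by
      ext i j
      exact hext _ _ (hx j)
    rw [e]
    exact hcheb.2 x hx hinj
  have hpos : ∀ᵐ x ∂(volume.restrict (Set.Icc a b)), 0 < extend ω x := by
    filter_upwards [hωpos, ae_restrict_mem measurableSet_Icc] with x hx hx'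
    rwa [hext _ _ hx']
  have hω0 : ∀ x ∈ Set.Icc a b, 0 ≤ extend ω x := by
    have h1 : extend ω =ᵐ[volume.restrict (Set.Icc a b)] fun x => |extend ω x| := by
      filter_upwards [hpos] with x hx
      rw [abs_of_pos hx]
    intro x hx
    rw [Measure.eqOn_Icc_of_ae_eq volume hab.ne h1 hωc.continuousOn hωc.abs.continuousOn hx]
    exact abs_nonneg _
  have hint : ∀ j, ∫ x in a..b, φ j x * ω x = ∫ x in a..b, extend (φ j) x * extend ω x := by
    intro j
    refine intervalIntegral.integral_congr fun x hx => ?_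
    rw [Set.uIcc_of_le hab.le] at hx
    simp only [hext _ _ hx]
  obtain ⟨y, W, hy, hW, hyW⟩ := hch.exists_nonneg_quadrature hab hc hωc hω0
  obtain ⟨hinj, hIoo, hne⟩ := hch.nodes_of_integral_eq_sum hab hc hωc hpos hy hyW
  have hsum : ∀ j, ∫ x in a..b, φ j x * ω x
      = ∑ k, φ j (y (Tuple.sort y k)) * W (Tuple.sort y k) := by
    intro j
    rw [hint, hyW, Equiv.sum_comp (Tuple.sort y) fun k => φ j (y k) * W k]
    simp only [hext _ _ (hy _)]
  have hmono : StrictMono (y ∘ Tuple.sort y) :=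
    (Tuple.monotone_sort y).strictMono_of_injective (hinj.comp (Equiv.injective _))
  refine ⟨(y ∘ Tuple.sort y, W ∘ Tuple.sort y), ⟨hmono, fun k => hIoo _,
    fun k => lt_of_le_of_ne (hW _) (hne _).symm, hsum⟩, ?_⟩
  rintro ⟨x, w⟩ ⟨hx, hxI, hw, hxw⟩
  obtain ⟨h1, h2⟩ := hcheb.quadrature_unique hab (by omega) hx hmono
    (fun k => Set.Ioo_subset_Icc_self (hxI k)) (fun k => hy _) (fun k => (hw k).ne')
    (w' := W ∘ Tuple.sort y) (fun k => hne _) fun j => (hxw j).symm.trans (hsum j)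
  exact Prod.ext h1 h2
end

section
/- Let λ_0, …, λ_{2N+1} be pairwise distinct real numbers and let x_0, …, x_N be pairwise distinct points in (0,1). Then the (2N+2)×(2N+2) matrix Q whose entry in row j and column 2i is x_i^{λ_j} and whose entry in row j and column 2i+1 is λ_j · x_i^{λ_j − 1}, for 0 ≤ j ≤ 2N+1 and 0 ≤ i ≤ N, has nonzero determinant. (Equivalently, the Hermite interpolation matrix of the functions φ_j(x) = x^{λ_j} and their derivatives at the nodes x_0, …, x_N is nonsingular.) -/
/-- A finite set `Z` of zeros of a differentiable function gives `#Z - 1` zeros of its derivative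
outside `Z`. -/
theorem exists_finset_deriv_zeros {f f' : ℝ → ℝ} (hf : ∀ t, HasDerivAt f (f' t) t)
    {Z : Finset ℝ} (hZ : ∀ t ∈ Z, f t = 0) :
    ∃ W : Finset ℝ, Disjoint W Z ∧ Z.card ≤ W.card + 1 ∧ ∀ t ∈ W, f' t = 0 := by
  have key : ∀ a b, ∃ c, a ∈ Z → b ∈ Z → a < b → (a < c ∧ c < b) ∧ f' c = 0 := by
    intro a b
    by_cases h : a ∈ Z ∧ b ∈ Z ∧ a < b
    · obtain ⟨ha, hb, hab⟩ := h
      obtain ⟨c, hc, hc'⟩ := exists_hasDerivAt_eq_zero hab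
        (fun t _ => (hf t).continuousAt.continuousWithinAt) ((hZ a ha).trans (hZ b hb).symm)
        fun t _ => hf t
      exact ⟨c, fun _ _ _ => ⟨hc, hc'⟩⟩
    · exact ⟨0, fun ha hb hab => (h ⟨ha, hb, hab⟩).elim⟩
  choose c hc using key
  let T := ((Z ×ˢ Z).filter fun p => p.1 < p.2).image fun p => c p.1 p.2
  refine ⟨T \ Z, Finset.sdiff_disjoint, Finset.card_le_sdiff_of_interleaved ?_, ?_⟩
  · intro a ha b hb hab _
    refine ⟨c a b, Finset.mem_image.2 ⟨(a, b), ?_, rfl⟩, (hc a b ha hb hab).1⟩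
    simp [ha, hb, hab]
  · intro t ht
    obtain ⟨p, hp, rfl⟩ := Finset.mem_image.1 (Finset.mem_sdiff.1 ht).1
    simp only [Finset.mem_filter, Finset.mem_product] at hp
    exact (hc p.1 p.2 hp.1.1 hp.1.2 hp.2).2

/-- An exponential sum with at most as many terms as zeros, where zeros in `D` count twice,
has vanishing coefficients. -/
theorem exp_sum_coeff_eq_zero {ι : Type*} {lam : ι → ℝ} (hlam : Function.Injective lam)
    (s : Finset ι) : ∀ (v : ι → ℝ) (Z D : Finset ℝ), D ⊆ Z → s.card ≤ Z.card + D.card →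
      (∀ t ∈ Z, ∑ j ∈ s, v j * Real.exp (lam j * t) = 0) →
      (∀ t ∈ D, ∑ j ∈ s, v j * (lam j * Real.exp (lam j * t)) = 0) →
      ∀ j ∈ s, v j = 0 := by
  classical
  induction s using Finset.induction_on with
  | empty => simp
  | insert k s hk ih =>
    intro v Z D hDZ hcard hZ hD
    have hderiv (t : ℝ) : HasDerivAt
        (fun t => ∑ j ∈ insert k s, v j * Real.exp ((lam j - lam k) * t))
        (∑ j ∈ insert k s, v j * ((lam j - lam k) * Real.exp ((lam j - lam k) * t))) t := by
      refine HasDerivAt.fun_sum fun j _ => HasDerivAt.const_mul _ ?_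
      simpa [mul_comm] using ((hasDerivAt_id t).const_mul (lam j - lam k)).exp
    have hexp (j : ι) (t : ℝ) :
        Real.exp ((lam j - lam k) * t) = Real.exp (lam j * t) * Real.exp (-(lam k * t)) := by
      rw [← Real.exp_add]; ring_nf
    have hzero : ∀ t ∈ Z, ∑ j ∈ insert k s, v j * Real.exp ((lam j - lam k) * t) = 0 := by
      intro t ht
      simp_rw [hexp, ← mul_assoc]
      rw [← Finset.sum_mul, hZ t ht, zero_mul]
    obtain ⟨W, hWZ, hWcard, hW⟩ := exists_finset_deriv_zeros hderiv hzero
    have hreduce (t : ℝ) : ∑ j ∈ s, v j * (lam j - lam k) * Real.exp (lam j * t) =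
        ∑ j ∈ insert k s, v j * ((lam j - lam k) * Real.exp (lam j * t)) := by
      rw [Finset.sum_insert hk]
      simp [mul_assoc]
    have hs : ∀ j ∈ s, v j = 0 := by
      have hv := ih (fun j => v j * (lam j - lam k)) (W ∪ D) ∅ (Finset.empty_subset _) ?_ ?_
        (by simp)
      · intro j hj
        have hne : lam j - lam k ≠ 0 := sub_ne_zero.2 fun h => hk (hlam h ▸ hj)
        exact (mul_eq_zero.1 (hv j hj)).resolve_right hne
      · rw [Finset.card_union_of_disjoint (hWZ.mono_right hDZ)]
        rw [Finset.card_insert_of_notMem hk] at hcard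
        simp only [Finset.card_empty]
        omega
      · intro t ht
        rw [hreduce]
        rcases Finset.mem_union.1 ht with ht | ht
        · have h := hW t ht
          simp_rw [hexp, ← mul_assoc] at h
          rw [← Finset.sum_mul] at h
          simpa [mul_assoc] using (mul_eq_zero.1 h).resolve_right (Real.exp_ne_zero _)
        · have h : ∑ j ∈ insert k s, v j * ((lam j - lam k) * Real.exp (lam j * t)) =
              ∑ j ∈ insert k s, v j * (lam j * Real.exp (lam j * t)) -
                lam k * ∑ j ∈ insert k s, v j * Real.exp (lam j * t) := by
            rw [Finset.mul_sum, ← Finset.sum_sub_distrib]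
            exact Finset.sum_congr rfl fun j _ => by ring
          rw [h, hD t ht, hZ t (hDZ ht), mul_zero, sub_zero]
    have hZne : Z.Nonempty := by
      rw [← Finset.card_pos]
      rw [Finset.card_insert_of_notMem hk] at hcard
      have := Finset.card_le_card hDZ
      omega
    obtain ⟨t, ht⟩ := hZne
    have h := hZ t ht
    rw [Finset.sum_insert hk, Finset.sum_eq_zero fun j hj => by rw [hs j hj, zero_mul],
      add_zero] at h
    exact (Finset.forall_mem_insert ..).2
      ⟨(mul_eq_zero.1 h).resolve_right (Real.exp_ne_zero _), hs⟩

theorem power_hermite_matrix_nonsingular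
    (N : ℕ) (lam : Fin (2 * N + 2) → ℝ) (hlam : Function.Injective lam)
    (x : Fin (N + 1) → ℝ) (hx : ∀ i, x i ∈ Set.Ioo (0:ℝ) 1)
    (hxdist : Function.Injective x) :
    (Matrix.of fun j c : Fin (2 * N + 2) =>
        if c.val % 2 = 0 then
          x ⟨c.val / 2, by omega⟩ ^ lam j
        else
          lam j * x ⟨c.val / 2, by omega⟩ ^ (lam j - 1)).det ≠ 0 := by
  intro hdet
  obtain ⟨v, hv, hvM⟩ := Matrix.exists_vecMul_eq_zero_iff.2 hdet
  have hexp (i : Fin (N + 1)) (j : Fin (2 * N + 2)) :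
      Real.exp (lam j * Real.log (x i)) = x i ^ lam j := by
    rw [Real.rpow_def_of_pos (hx i).1, mul_comm]
  have hval (i : Fin (N + 1)) : ∑ j, v j * x i ^ lam j = 0 := by
    simpa [Matrix.vecMul, dotProduct] using congrFun hvM ⟨2 * i.val, by omega⟩
  have hder (i : Fin (N + 1)) : ∑ j, v j * (lam j * x i ^ (lam j - 1)) = 0 := by
    have hdiv : (2 * i.val + 1) / 2 = i.val := by omega
    simpa [Matrix.vecMul, dotProduct, hdiv] using congrFun hvM ⟨2 * i.val + 1, by omega⟩
  have hlog : Function.Injective fun i => Real.log (x i) := fun i i' h =>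
    hxdist (Real.log_injOn_pos (hx i).1 (hx i').1 h)
  let Z := Finset.univ.image fun i => Real.log (x i)
  have hZcard : Z.card = N + 1 := by
    simp [Z, Finset.card_image_of_injective _ hlog]
  refine hv (funext fun j => exp_sum_coeff_eq_zero hlam Finset.univ v Z Z subset_rfl ?_ ?_ ?_ j
    (Finset.mem_univ j))
  · rw [hZcard, Finset.card_univ, Fintype.card_fin]
    omega
  · intro t ht
    obtain ⟨i, -, rfl⟩ := Finset.mem_image.1 ht
    simpa only [hexp] using hval i
  · intro t ht
    obtain ⟨i, -, rfl⟩ := Finset.mem_image.1 ht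
    have h : ∀ j, v j * (lam j * x i ^ lam j) = v j * (lam j * x i ^ (lam j - 1)) * x i := by
      intro j
      rw [Real.rpow_sub_one (hx i).1.ne']
      field_simp [(hx i).1.ne']
    simp only [hexp, h]
    rw [← Finset.sum_mul, hder i, zero_mul]
end

section
/- Let z_0, …, z_N be pairwise distinct real numbers and y_0, …, y_{2N+1} be pairwise distinct real numbers. Then the (2N+2)×(2N+2) matrix whose entry in row i and column 2j is e^{z_j y_i} and whose entry in row i and column 2j+1 is y_i · e^{z_j (y_i − 1)}, for 0 ≤ i ≤ 2N+1 and 0 ≤ j ≤ N, has nonzero determinant. -/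
/-- Between consecutive zeros of a differentiable function lie zeros of its derivative. -/
theorem exists_strictMono_hasDerivAt_eq_zero {f f' : ℝ → ℝ} (hf : ∀ t, HasDerivAt f (f' t) t)
    {n : ℕ} {x : Fin (n + 1) → ℝ} (hx : StrictMono x) (hfx : ∀ i, f (x i) = 0) :
    ∃ ξ : Fin n → ℝ, StrictMono ξ ∧ ∀ i, f' (ξ i) = 0 := by
  have key (i : Fin n) : ∃ c ∈ Set.Ioo (x i.castSucc) (x i.succ), f' c = 0 :=
    exists_hasDerivAt_eq_zero (hx i.castSucc_lt_succ)
      (fun t _ => (hf t).continuousAt.continuousWithinAt)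
      ((hfx _).trans (hfx _).symm) (fun t _ => hf t)
  choose ξ hξ hξ0 using key
  refine ⟨ξ, fun i j hij => ?_, hξ0⟩
  have hle : x i.succ ≤ x j.castSucc := hx.monotone (Fin.succ_le_castSucc_iff.mpr hij)
  exact (hξ i).2.trans_le (hle.trans (hξ j).1.le)

open Polynomial in
/-- A real polynomial solving `P' + c P = 0` with `c ≠ 0` vanishes. -/
theorem Polynomial.eq_zero_of_derivative_add_C_mul_eq_zero {P : ℝ[X]} {c : ℝ} (hc : c ≠ 0)
    (h : derivative P + C c * P = 0) : P = 0 := by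
  by_contra hP
  have hdeg : (derivative P).degree < P.degree := degree_derivative_lt hP
  have h1 : C c * P = -derivative P := (neg_eq_of_add_eq_zero_right h).symm
  have h2 : P.degree = (derivative P).degree := by
    rw [← degree_C_mul hc, h1, degree_neg]
  exact hdeg.ne h2.symm

open Polynomial in
/-- An exponential polynomial `∑ j, P j * exp (z j * t)` with `deg P j < d j` and `∑ j, d j`
distinct zeros has vanishing coefficients. -/
theorem exponential_polynomial_coeff_eq_zero {ι : Type*} [Fintype ι] {z : ι → ℝ}
    (hz : Function.Injective z) {n : ℕ} (d : ι → ℕ) (hd : ∑ j, d j = n) (P : ι → ℝ[X])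
    (hP : ∀ j, (P j).degree < d j) {x : Fin n → ℝ} (hx : StrictMono x)
    (h0 : ∀ i, ∑ j, (P j).eval (x i) * Real.exp (z j * x i) = 0) (j : ι) : P j = 0 := by
  classical
  induction n generalizing d P j with
  | zero =>
    have hdj : d j = 0 := by simpa using (Finset.sum_eq_zero_iff.mp hd) j (Finset.mem_univ j)
    have := hP j
    rw [← degree_eq_bot]
    simpa [hdj] using this
  | succ n ih =>
    obtain ⟨k, -, hk⟩ : ∃ k ∈ Finset.univ, d k ≠ 0 := by
      by_contra! hall
      rw [Finset.sum_eq_zero hall] at hd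
      omega
    have hshift (R : ι → ℝ[X]) (t : ℝ) :
        ∑ j, (R j).eval t * Real.exp ((z j - z k) * t) =
          (∑ j, (R j).eval t * Real.exp (z j * t)) * Real.exp (-(z k * t)) := by
      rw [Finset.sum_mul]
      refine Finset.sum_congr rfl fun j _ => ?_
      rw [mul_assoc, ← Real.exp_add]
      ring_nf
    let Q : ι → ℝ[X] := fun j => derivative (P j) + C (z j - z k) * P j
    have hderiv (t : ℝ) :
        HasDerivAt (fun t => ∑ j, (P j).eval t * Real.exp ((z j - z k) * t))
          (∑ j, (Q j).eval t * Real.exp ((z j - z k) * t)) t := by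
      refine HasDerivAt.fun_sum fun j _ => ?_
      have he : HasDerivAt (fun t => Real.exp ((z j - z k) * t))
          (Real.exp ((z j - z k) * t) * (z j - z k)) t := by
        simpa using ((hasDerivAt_id t).const_mul (z j - z k)).exp
      refine (((P j).hasDerivAt t).mul he).congr_deriv ?_
      simp only [Q, eval_add, eval_mul, eval_C]
      ring
    obtain ⟨ξ, hξ, hξ0⟩ := exists_strictMono_hasDerivAt_eq_zero hderiv hx
      (fun i => by rw [hshift, h0, zero_mul])
    have hQdeg (j : ι) : (Q j).degree < (Function.update d k (d k - 1) j : ℕ) := by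
      by_cases hjk : j = k
      · subst hjk
        simp only [Q, sub_self, C_0, zero_mul, add_zero, Function.update_self]
        by_cases hPj : P j = 0
        · simp [hPj, bot_lt_iff_ne_bot]
        · have h1 : (derivative (P j)).degree < (P j).degree := degree_derivative_lt hPj
          have h2 := hP j
          rw [degree_eq_natDegree hPj] at h1 h2
          have h3 : (P j).natDegree ≤ d j - 1 := by
            have : (P j).natDegree < d j := by exact_mod_cast h2
            omega
          exact h1.trans_le (by exact_mod_cast h3)
      · rw [Function.update_of_ne hjk]
        refine (degree_add_le _ _).trans_lt (max_lt ?_ ?_)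
        · exact degree_derivative_le.trans_lt (hP j)
        · rw [degree_C_mul (sub_ne_zero.mpr (hz.ne hjk))]
          exact hP j
    have hdsum : ∑ j, Function.update d k (d k - 1) j = n := by
      rw [Finset.sum_update_of_mem (Finset.mem_univ k)]
      rw [← Finset.add_sum_erase _ _ (Finset.mem_univ k)] at hd
      rw [Finset.sdiff_singleton_eq_erase]
      omega
    have hQ := ih _ hdsum Q hQdeg hξ fun i => by
      have := hξ0 i
      rw [hshift] at this
      exact (mul_eq_zero.mp this).resolve_right (Real.exp_ne_zero _)
    have hne (j : ι) (hjk : j ≠ k) : P j = 0 :=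
      eq_zero_of_derivative_add_C_mul_eq_zero (sub_ne_zero.mpr (hz.ne hjk)) (hQ j)
    by_cases hjk : j = k
    · subst hjk
      have hder : derivative (P j) = 0 := by simpa [Q] using hQ j
      have hconst := eq_C_of_derivative_eq_zero hder
      have hzero := h0 0
      rw [Finset.sum_eq_single j (fun i _ hi => by simp [hne i hi]) (by simp)] at hzero
      have := (mul_eq_zero.mp hzero).resolve_right (Real.exp_ne_zero _)
      rw [hconst, eval_C] at this
      rw [hconst, this, C_0]
    · exact hne j hjk

/-- A sum over `Fin (2 * m)` grouped into consecutive pairs. -/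
theorem Fin.sum_univ_two_mul {M : Type*} [AddCommMonoid M] (m : ℕ) (g : Fin (2 * m) → M) :
    ∑ c, g c = ∑ j : Fin m, (g ⟨2 * j, by omega⟩ + g ⟨2 * j + 1, by omega⟩) := by
  induction m with
  | zero => rfl
  | succ m ih =>
    rw [Fin.sum_univ_castSucc (n := m)]
    refine (Fin.sum_univ_castSucc (n := 2 * m + 1) g).trans ?_
    rw [Fin.sum_univ_castSucc (n := 2 * m), ih fun c => g c.castSucc.castSucc, add_assoc]
    rfl

theorem exponential_hermite_matrix_nonsingular
    (N : ℕ) (z : Fin (N + 1) → ℝ) (hz : Function.Injective z)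
    (y : Fin (2 * N + 2) → ℝ) (hy : Function.Injective y) :
    (Matrix.of fun i c : Fin (2 * N + 2) =>
        if c.val % 2 = 0 then
          Real.exp (z ⟨c.val / 2, by omega⟩ * y i)
        else
          y i * Real.exp (z ⟨c.val / 2, by omega⟩ * (y i - 1))).det ≠ 0 := by
  have hodd_lt (j : Fin (N + 1)) : 2 * j.val + 1 < 2 * N + 2 := by omega
  have heven_lt (j : Fin (N + 1)) : 2 * j.val < 2 * N + 2 := by omega
  intro hdet
  obtain ⟨v, hv, hMv⟩ := Matrix.exists_mulVec_eq_zero_iff.mpr hdet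
  let P : Fin (N + 1) → Polynomial ℝ := fun j =>
    Polynomial.C (v ⟨2 * j + 1, hodd_lt j⟩ * Real.exp (-z j)) * Polynomial.X +
      Polynomial.C (v ⟨2 * j, heven_lt j⟩)
  have hrow (i : Fin (2 * N + 2)) :
      ∑ j, (P j).eval (y i) * Real.exp (z j * y i) = 0 := by
    have h := congrFun hMv i
    simp only [Matrix.mulVec, dotProduct, Matrix.of_apply, Pi.zero_apply] at h
    rw [← h]
    refine Eq.trans ?_ (Fin.sum_univ_two_mul (N + 1) _).symm
    refine Finset.sum_congr rfl fun j _ => ?_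
    have h1 : (2 * (j : ℕ) + 1) / 2 = j := by omega
    have h2 : (2 * (j : ℕ) + 1) % 2 = 1 := by omega
    have h3 : Real.exp (z j * (y i - 1)) = Real.exp (-z j) * Real.exp (z j * y i) := by
      rw [← Real.exp_add]
      ring_nf
    simp [P, h1, h2, h3]
    ring
  have hcard : (Finset.univ.image y).card = 2 * N + 2 := by
    simp [Finset.card_image_of_injective _ hy]
  have hP := exponential_polynomial_coeff_eq_zero hz (n := 2 * N + 2) (fun _ => 2)
    (by simp; ring) P (fun j => Polynomial.degree_linear_lt)
    ((Finset.univ.image y).orderEmbOfFin hcard).strictMono fun i => by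
      obtain ⟨k, -, hk⟩ := Finset.mem_image.mp (Finset.orderEmbOfFin_mem _ hcard i)
      rw [← hk]
      exact hrow k
  apply hv
  funext c
  have hodd (j : Fin (N + 1)) : v ⟨2 * j + 1, hodd_lt j⟩ = 0 := by
    simpa [P] using congrArg (Polynomial.coeff · 1) (hP j)
  have heven (j : Fin (N + 1)) : v ⟨2 * j, heven_lt j⟩ = 0 := by
    simpa [P] using congrArg (Polynomial.coeff · 0) (hP j)
  have hlt : c.val / 2 < N + 1 := by omega
  rcases Nat.mod_two_eq_zero_or_one c.val with hc | hc
  · have hcv : 2 * (c.val / 2) = c.val := by omega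
    simpa only [hcv, Fin.eta, Pi.zero_apply] using heven ⟨c.val / 2, hlt⟩
  · have hcv : 2 * (c.val / 2) + 1 = c.val := by omega
    simpa only [hcv, Fin.eta, Pi.zero_apply] using hodd ⟨c.val / 2, hlt⟩
end
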